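/- Suppose a and b are states such that (a, b) is possible (a ⇌ b), and let I_b be a bit state. Then for all integers n, m ≥ 0, either a + m·I_b → b + n·I_b or b + n·I_b → a + m·I_b, where k·I_b denotes the combination of k copies of I_b (and 0 copies means the bare state). -/

import Mathlib

structure EidoSys where
  State : Type
  [decEq : DecidableEq State]
  Eido : Set (Finset State)
  pair : State → State → State
  Sim : Finset State → Finset State → Prop
  Arrow : Finset State → Finset State → Prop
  pair_inj : ∀ a b a' b', pair a b = pair a' b' → a = a' ∧ b = b'
  eido_nonempty : ∀ A ∈ Eido, A.Nonempty
  singleton_mem : ∀ a : State, ({a} : Finset State) ∈ Eido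
  comb_mem : ∀ A B : Finset State, Finset.image₂ pair A B ∈ Eido ↔ A ∈ Eido ∧ B ∈ Eido
  subset_mem : ∀ A B : Finset State, A ∈ Eido → B ⊆ A → B.Nonempty → B ∈ Eido
  sim_refl : ∀ A : Finset State, Sim A A
  sim_symm : ∀ A B : Finset State, Sim A B → Sim B A
  sim_trans : ∀ A B C : Finset State, Sim A B → Sim B C → Sim A C
  sim_comm : ∀ A B : Finset State, Sim (Finset.image₂ pair A B) (Finset.image₂ pair B A)
  sim_assoc : ∀ A B C : Finset State,
    Sim (Finset.image₂ pair (Finset.image₂ pair A B) C) (Finset.image₂ pair A (Finset.image₂ pair B C))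
  sim_congr : ∀ A B C : Finset State, Sim A B → Sim (Finset.image₂ pair A C) (Finset.image₂ pair B C)
  arrow_of_sim : ∀ A B : Finset State, A ∈ Eido → B ∈ Eido → Sim A B → Arrow A B
  arrow_trans : ∀ A B C : Finset State, Arrow A B → Arrow B C → Arrow A C
  arrow_comb : ∀ A B C : Finset State, Arrow A B → Arrow (Finset.image₂ pair A C) (Finset.image₂ pair B C)
  arrow_cancel : ∀ (A B : Finset State) (s : State),
    Arrow (Finset.image₂ pair A {s}) (Finset.image₂ pair B {s}) → Arrow A B
  arrow_nsubset : ∀ A B : Finset State, A ∈ Eido → B ∈ Eido → B ⊂ A → ¬ Arrow A B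
  arrow_subset_single : ∀ (A A' : Finset State) (b : State),
    A ∈ Eido → A' ⊆ A → A'.Nonempty → Arrow A {b} → Arrow A' {b}
  arrow_union : ∀ A₁ A₂ B₁ B₂ : Finset State,
    A₁ ∈ Eido → A₂ ∈ Eido → B₁ ∈ Eido → B₂ ∈ Eido →
    Disjoint A₁ A₂ → Disjoint B₁ B₂ →
    (∀ a ∈ A₁ ∪ A₂, ∀ b ∈ A₁ ∪ A₂, Arrow {a} {b} ∨ Arrow {b} {a}) →
    (∀ a ∈ B₁ ∪ B₂, ∀ b ∈ B₁ ∪ B₂, Arrow {a} {b} ∨ Arrow {b} {a}) →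
    Arrow A₁ B₁ → Arrow A₂ B₂ → Arrow (A₁ ∪ A₂) (B₁ ∪ B₂)

attribute [instance] EidoSys.decEq

namespace EidoSys

variable (S : EidoSys)

/-- Combination of eidostates: the Cartesian product, realized via the pairing map. -/
def comb (A B : Finset S.State) : Finset S.State := Finset.image₂ S.pair A B

/-- The process (A,B) is possible: A ⇌ B. -/
def Pos (A B : Finset S.State) : Prop := S.Arrow A B ∨ S.Arrow B A

/-- A ↔ B. -/
def Rev (A B : Finset S.State) : Prop := S.Arrow A B ∧ S.Arrow B A

/-- Uniform eidostate. -/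
def Uniform (A : Finset S.State) : Prop := A ∈ S.Eido ∧ ∀ a ∈ A, ∀ b ∈ A, S.Pos {a} {b}

/-- Record state: a ↔ a + r for some state a. -/
def IsRecord (r : S.State) : Prop := ∃ a : S.State, S.Rev {a} (S.comb {a} {r})

/-- Information state: an eidostate all of whose elements are record states. -/
def IsInfo (I : Finset S.State) : Prop := I ∈ S.Eido ∧ ∀ r ∈ I, S.IsRecord r

/-- Bit state: an information state with exactly two elements. -/
def IsBit (I : Finset S.State) : Prop := S.IsInfo I ∧ I.card = 2

/-- Information axiom: there exist a bit state and a possible bit process. -/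
def InfoAxiom : Prop := ∃ (r : S.State) (I : Finset S.State), S.IsRecord r ∧ S.IsBit I ∧ S.Pos {r} I

/-- Demon axiom. -/
def DemonAxiom : Prop := ∀ a b : S.State, ∀ J : Finset S.State, S.IsInfo J →
    S.Arrow {a} (S.comb {b} J) →
    (∃ I : Finset S.State, S.IsInfo I ∧ S.Arrow {b} (S.comb {a} I)) ∧
    (∀ I : Finset S.State, S.IsInfo I → S.Arrow {a} (S.comb {b} I) ∨ S.Arrow (S.comb {b} I) {a})

/-- `copies A n` is the combination of `n+1` copies of `A` (so `copies A 0 = A`). -/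
def copies (A : Finset S.State) : ℕ → Finset S.State
  | 0 => A
  | n + 1 => S.comb A (copies A n)

/-- Stability axiom: if nA → nB + J for arbitrarily large n, then A → B. -/
def StabilityAxiom : Prop := ∀ A B J : Finset S.State, A ∈ S.Eido → B ∈ S.Eido → S.IsInfo J →
    (∀ N : ℕ, ∃ n ≥ N, S.Arrow (S.copies A n) (S.comb (S.copies B n) J)) → S.Arrow A B

/-- State-equivalence axiom. -/
def StateEquivAxiom : Prop := ∀ E : Finset S.State, S.Uniform E →
    ∃ e x y : S.State, S.Arrow {x} {y} ∧ S.Rev (S.comb E {x}) (S.comb {e} {y})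

/-- `addCopies A B k` is A + k·B (k copies of B appended to A). -/
def addCopies (A B : Finset S.State) : ℕ → Finset S.State
  | 0 => A
  | k + 1 => S.comb (addCopies A B k) B

/-- A designated set of mechanical states. -/
def MechSet (M : Set S.State) : Prop :=
  (∀ l ∈ M, ∀ m ∈ M, S.pair l m ∈ M) ∧
  (∀ l ∈ M, ∀ m ∈ M, S.Arrow {l} {m} → S.Arrow {m} {l})

/-- Component of content on uniform eidostates. -/
def IsCoCU (Q : Finset S.State → ℝ) : Prop :=
  (∀ E F : Finset S.State, S.Uniform E → S.Uniform F → Q (S.comb E F) = Q E + Q F) ∧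
  (∀ E F : Finset S.State, S.Uniform E → S.Uniform F → S.Pos E F → Q E = Q F)

/-- Entropy function on the uniform eidostates (relative to mechanical states M). -/
def IsEntropyU (M : Set S.State) (Ent : Finset S.State → ℝ) : Prop :=
  (∀ E F : Finset S.State, S.Uniform E → S.Uniform F → Ent (S.comb E F) = Ent E + Ent F) ∧
  (∀ E F : Finset S.State, S.Uniform E → S.Uniform F → S.Pos E F → (S.Arrow E F ↔ Ent E ≤ Ent F)) ∧
  (∀ m ∈ M, Ent {m} = 0) ∧
  (∀ I : Finset S.State, S.IsInfo I → Ent I = Real.logb 2 (I.card))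

end EidoSys

namespace EidoSys

variable {S : EidoSys}

theorem comb_singleton (a r : S.State) : S.comb {a} {r} = {S.pair a r} := by
  simp [comb]

/-- Appending a record state to any state is reversible. -/
theorem IsRecord.rev {r : S.State} (hr : S.IsRecord r) (b : S.State) :
    S.Rev {b} (S.comb {b} {r}) := by
  obtain ⟨c, h₁, h₂⟩ := hr
  have mem : ∀ x : S.State, ({x} : Finset S.State) ∈ S.Eido := S.singleton_mem
  have swap : S.Sim (S.comb (S.comb {c} {r}) {b}) (S.comb (S.comb {b} {r}) {c}) :=
    S.sim_trans _ _ _ (S.sim_comm _ _) <|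
      S.sim_trans _ _ _ (S.sim_symm _ _ (S.sim_assoc _ _ _)) <|
      S.sim_trans _ _ _ (S.sim_congr _ _ _ (S.sim_comm _ _)) <|
      S.sim_trans _ _ _ (S.sim_assoc _ _ _)
        (S.sim_comm _ _)
  have mem₁ : S.comb (S.comb {c} {r}) {b} ∈ S.Eido := by
    simp only [comb_singleton, mem]
  have mem₂ : S.comb (S.comb {b} {r}) {c} ∈ S.Eido := by
    simp only [comb_singleton, mem]
  have mem₃ : S.comb {c} {b} ∈ S.Eido := by simp only [comb_singleton, mem]
  have mem₄ : S.comb {b} {c} ∈ S.Eido := by simp only [comb_singleton, mem]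
  constructor
  · refine S.arrow_cancel _ _ c ?_
    exact S.arrow_trans _ _ _ (S.arrow_of_sim _ _ mem₄ mem₃ (S.sim_comm _ _)) <|
      S.arrow_trans _ _ _ (S.arrow_comb _ _ _ h₁) (S.arrow_of_sim _ _ mem₁ mem₂ swap)
  · refine S.arrow_cancel _ _ c ?_
    exact S.arrow_trans _ _ _ (S.arrow_of_sim _ _ mem₂ mem₁ (S.sim_symm _ _ swap)) <|
      S.arrow_trans _ _ _ (S.arrow_comb _ _ _ h₂) (S.arrow_of_sim _ _ mem₃ mem₄ (S.sim_comm _ _))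

theorem IsRecord.pair {r s : S.State} (hr : S.IsRecord r) (hs : S.IsRecord s) :
    S.IsRecord (S.pair r s) := by
  have assoc : S.Sim (S.comb (S.comb {r} {r}) {s}) (S.comb {r} (S.comb {r} {s})) :=
    S.sim_assoc _ _ _
  simp only [comb_singleton] at assoc
  have h₁ := hr.rev r
  have h₂ := hs.rev (S.pair r r)
  rw [comb_singleton] at h₁ h₂
  refine ⟨r, ?_⟩
  rw [comb_singleton]
  exact ⟨S.arrow_trans _ _ _ h₁.1 <| S.arrow_trans _ _ _ h₂.1 <|
      S.arrow_of_sim _ _ (S.singleton_mem _) (S.singleton_mem _) assoc,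
    S.arrow_trans _ _ _ (S.arrow_of_sim _ _ (S.singleton_mem _) (S.singleton_mem _)
      (S.sim_symm _ _ assoc)) <| S.arrow_trans _ _ _ h₂.2 h₁.2⟩

theorem IsInfo.comb {I J : Finset S.State} (hI : S.IsInfo I) (hJ : S.IsInfo J) :
    S.IsInfo (S.comb I J) := by
  refine ⟨(S.comb_mem _ _).2 ⟨hI.1, hJ.1⟩, fun x hx => ?_⟩
  obtain ⟨r, hr, s, hs, rfl⟩ := Finset.mem_image₂.1 hx
  exact (hI.2 r hr).pair (hJ.2 s hs)

theorem IsInfo.singleton {r : S.State} (hr : S.IsRecord r) : S.IsInfo {r} :=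
  ⟨S.singleton_mem r, fun x hx => by rwa [Finset.mem_singleton.1 hx]⟩

theorem addCopies_mem {A I : Finset S.State} (hA : A ∈ S.Eido) (hI : I ∈ S.Eido) (k : ℕ) :
    S.addCopies A I k ∈ S.Eido := by
  induction k with
  | zero => exact hA
  | succ k ih => exact (S.comb_mem _ _).2 ⟨ih, hI⟩

theorem exists_sim_addCopies {I : Finset S.State} (A : Finset S.State) (hI : S.IsInfo I) (k : ℕ) :
    ∃ J, S.IsInfo J ∧ S.Sim (S.addCopies A I (k + 1)) (S.comb A J) := by
  induction k with
  | zero => exact ⟨I, hI, S.sim_refl _⟩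
  | succ k ih =>
    obtain ⟨J, hJ, h⟩ := ih
    exact ⟨S.comb J I, hJ.comb hI,
      S.sim_trans _ _ _ (S.sim_congr _ _ _ h) (S.sim_assoc _ _ _)⟩

theorem addCopies_add (A I : Finset S.State) (k m : ℕ) :
    S.addCopies A I (k + m) = S.addCopies (S.addCopies A I k) I m := by
  induction m with
  | zero => rfl
  | succ m ih => exact congrArg (S.comb · I) ih

theorem arrow_addCopies {A B : Finset S.State} (h : S.Arrow A B) (I : Finset S.State) (m : ℕ) :
    S.Arrow (S.addCopies A I m) (S.addCopies B I m) := by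
  induction m with
  | zero => exact h
  | succ m ih => exact S.arrow_comb _ _ _ ih

/-- If `a` and `b` are comparable, then so are `a` and `b` with any information state appended. -/
theorem DemonAxiom.pos_comb (hdemon : S.DemonAxiom) {a b r : S.State} (hr : S.IsRecord r)
    (hab : S.Pos {a} {b}) {I : Finset S.State} (hI : S.IsInfo I) :
    S.Pos {a} (S.comb {b} I) := by
  have key : ∃ J, S.IsInfo J ∧ S.Arrow {a} (S.comb {b} J) := by
    rcases hab with h | h
    · exact ⟨{r}, .singleton hr, S.arrow_trans _ _ _ h (hr.rev b).1⟩
    · exact (hdemon b a {r} (.singleton hr) (S.arrow_trans _ _ _ h (hr.rev a).1)).1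
  obtain ⟨J, hJ, h⟩ := key
  exact (hdemon a b J hJ h).2 I hI

theorem DemonAxiom.pos_addCopies (hdemon : S.DemonAxiom) {a b : S.State} (hab : S.Pos {a} {b})
    {I : Finset S.State} (hI : S.IsInfo I) (k : ℕ) :
    S.Pos {a} (S.addCopies {b} I k) := by
  cases k with
  | zero => exact hab
  | succ k =>
    obtain ⟨r, hr⟩ := S.eido_nonempty I hI.1
    obtain ⟨J, hJ, hsim⟩ := exists_sim_addCopies {b} hI k
    have mem₁ : S.addCopies {b} I (k + 1) ∈ S.Eido := addCopies_mem (S.singleton_mem b) hI.1 _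
    have mem₂ : S.comb {b} J ∈ S.Eido := (S.comb_mem _ _).2 ⟨S.singleton_mem b, hJ.1⟩
    rcases hdemon.pos_comb (hI.2 r hr) hab hJ with h | h
    · exact .inl (S.arrow_trans _ _ _ h (S.arrow_of_sim _ _ mem₂ mem₁ (S.sim_symm _ _ hsim)))
    · exact .inr (S.arrow_trans _ _ _ (S.arrow_of_sim _ _ mem₁ mem₂ hsim) h)

theorem DemonAxiom.pos_addCopies_of_le (hdemon : S.DemonAxiom) {a b : S.State}
    (hab : S.Pos {a} {b}) {I : Finset S.State} (hI : S.IsInfo I) {m n : ℕ} (hmn : m ≤ n) :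
    S.Pos (S.addCopies {a} I m) (S.addCopies {b} I n) := by
  obtain ⟨k, rfl⟩ := Nat.exists_eq_add_of_le' hmn
  rw [addCopies_add]
  exact (hdemon.pos_addCopies hab hI k).imp (arrow_addCopies · I m) (arrow_addCopies · I m)

end EidoSys

/-- If a ⇌ b and I_b is a bit state, then for all n, m ≥ 0,
either a + m·I_b → b + n·I_b or b + n·I_b → a + m·I_b. -/
theorem stmt8 (S : EidoSys) (hinfo : S.InfoAxiom) (hdemon : S.DemonAxiom)
    (a b : S.State) (hab : S.Pos {a} {b}) (Ib : Finset S.State) (hIb : S.IsBit Ib) :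
    ∀ n m : ℕ,
      S.Arrow (S.addCopies {a} Ib m) (S.addCopies {b} Ib n) ∨
      S.Arrow (S.addCopies {b} Ib n) (S.addCopies {a} Ib m) := by
  intro n m
  rcases le_total m n with h | h
  · exact hdemon.pos_addCopies_of_le hab hIb.1 h
  · exact (hdemon.pos_addCopies_of_le hab.symm hIb.1 h).symm
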